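/- Fix r ≥ 0, σ > 0, Δt > 0, γ̂ > 0 with γ̂ < γ̂*. Define V(P) := 2√P. Then for every P > 0, the one-step continuation value e^{-rΔt}·E[V(P e^{(r-σ²/2)Δt+σ√Δt Z}) + γ̂ F(P, P e^{(r-σ²/2)Δt+σ√Δt Z})] equals 2√P·[e^{-(r+σ²/4)Δt/2} + (1 - e^{-(r+σ²/4)Δt/2})·γ̂/γ̂*] and is strictly less than 2√P; hence V(P) = 2√P satisfies the dynamic programming equation V(P) = max{2√P, continuation value}. -/

import Mathlib

open Real MeasureTheory ProbabilityTheory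

/-- standard normal CDF -/
noncomputable def Phi (x : ℝ) : ℝ := ∫ t in Set.Iic x, Real.exp (-t^2/2) / Real.sqrt (2*π)

/-- critical fee level γ̂* from the CPMM valuation theorem -/
noncomputable def gammaStar (r σ Δt : ℝ) : ℝ :=
  2 * (-1 + (Phi ((r + σ^2/2) * Real.sqrt Δt / σ)
      - Real.exp (-(r*Δt)) * Phi ((r - σ^2/2) * Real.sqrt Δt / σ)) /
      (1 - Real.exp (-(r + σ^2/4)*Δt/2)))⁻¹

/-- CPMM per-block fee functional, with x⁺ = max x 0. -/
noncomputable def F (P₀ P₁ : ℝ) : ℝ :=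
  P₁ * max (1 / Real.sqrt P₁ - 1 / Real.sqrt P₀) 0 + max (Real.sqrt P₁ - Real.sqrt P₀) 0

lemma Phi_eq_integral_indicator (c : ℝ) :
    Phi c = ∫ t, (Set.Iic c).indicator (gaussianPDFReal 0 1) t := by
  rw [Phi, integral_indicator measurableSet_Iic]
  refine setIntegral_congr_fun measurableSet_Iic fun t _ => ?_
  simp only [gaussianPDFReal, NNReal.coe_one, mul_one, sub_zero]
  rw [div_eq_inv_mul]

lemma Phi_neg (c : ℝ) : Phi (-c) = 1 - Phi c := by
  have hneg : Phi (-c) = ∫ t in Set.Ioi c, gaussianPDFReal 0 1 t := by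
    rw [Phi_eq_integral_indicator, integral_indicator measurableSet_Iic]
    have h := integral_comp_neg_Iic (-c) (gaussianPDFReal 0 1)
    rw [neg_neg] at h
    rw [← h]
    exact setIntegral_congr_fun measurableSet_Iic fun t _ => by simp [gaussianPDFReal]
  have hadd := intervalIntegral.integral_Iic_add_Ioi (b := c) (μ := volume)
    (integrable_gaussianPDFReal 0 1).integrableOn (integrable_gaussianPDFReal 0 1).integrableOn
  rw [integral_gaussianPDFReal_eq_one 0 one_ne_zero, ← hneg,
    ← integral_indicator measurableSet_Iic, ← Phi_eq_integral_indicator] at hadd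
  linarith

lemma integral_exp_mul_gaussianReal (s : ℝ) :
    ∫ x, Real.exp (s * x) ∂gaussianReal 0 1 = Real.exp (s ^ 2 / 2) := by
  simpa [mgf] using congrFun (mgf_id_gaussianReal (μ := 0) (v := 1)) s

lemma setIntegral_Iic_exp_mul_gaussianReal (s c : ℝ) :
    ∫ x in Set.Iic c, Real.exp (s * x) ∂gaussianReal 0 1
      = Real.exp (s ^ 2 / 2) * Phi (c - s) := by
  rw [← integral_indicator measurableSet_Iic, integral_gaussianReal_eq_integral_smul one_ne_zero,
    Phi_eq_integral_indicator,
    ← integral_sub_right_eq_self (fun t => (Set.Iic (c - s)).indicator (gaussianPDFReal 0 1) t) s,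
    ← integral_const_mul]
  congr 1 with x
  by_cases hx : x ≤ c
  · have hx' : x - s ≤ c - s := by linarith
    simp only [Set.indicator, Set.mem_Iic, hx, hx', if_true, gaussianPDFReal, NNReal.coe_one,
      mul_one, sub_zero, smul_eq_mul]
    rw [mul_assoc, mul_left_comm (Real.exp (s ^ 2 / 2)), ← Real.exp_add, ← Real.exp_add]
    ring_nf
  · have hx' : ¬ x - s ≤ c - s := by linarith
    simp [Set.indicator, hx]

lemma integrable_exp_add_mul_gaussianReal (m s : ℝ) :
    Integrable (fun x => Real.exp (m + s * x)) (gaussianReal 0 1) := by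
  simp_rw [Real.exp_add]
  exact (integrable_exp_mul_gaussianReal s).const_mul _

lemma integrable_min_exp_gaussianReal (m s : ℝ) :
    Integrable (fun x => min (Real.exp (m + s * x)) 1) (gaussianReal 0 1) :=
  (integrable_exp_add_mul_gaussianReal m s).inf (integrable_const 1)

lemma integral_min_exp_gaussianReal (m : ℝ) {s : ℝ} (hs : 0 < s) :
    ∫ x, min (Real.exp (m + s * x)) 1 ∂gaussianReal 0 1
      = Real.exp (m + s ^ 2 / 2) * (1 - Phi (m / s + s)) + Phi (m / s) := by
  have hiff (x : ℝ) : m + s * x ≤ 0 ↔ x ≤ -(m / s) := by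
    rw [← neg_div, le_div_iff₀ hs]
    constructor <;> intro h <;> linarith
  rw [← intervalIntegral.integral_Iic_add_Ioi (b := -(m / s))
    (integrable_min_exp_gaussianReal m s).integrableOn
    (integrable_min_exp_gaussianReal m s).integrableOn]
  congr 1
  · rw [setIntegral_congr_fun (g := fun x => Real.exp m * Real.exp (s * x)) measurableSet_Iic
      fun x hx => ?_, integral_const_mul, setIntegral_Iic_exp_mul_gaussianReal, ← Phi_neg,
      Real.exp_add, mul_assoc, neg_add']
    exact (min_eq_left (Real.exp_le_one_iff.mpr ((hiff x).mpr hx))).trans (Real.exp_add _ _)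
  · rw [setIntegral_congr_fun (g := fun _ => (1 : ℝ)) measurableSet_Ioi fun x hx => ?_]
    · have hadd := intervalIntegral.integral_Iic_add_Ioi (b := -(m / s)) (f := fun _ => (1 : ℝ))
        (μ := gaussianReal 0 1) (integrable_const 1).integrableOn (integrable_const 1).integrableOn
      have hIic := setIntegral_Iic_exp_mul_gaussianReal 0 (-(m / s))
      simp only [zero_mul, Real.exp_zero] at hIic
      have htotal : ∫ _, (1 : ℝ) ∂gaussianReal 0 1 = 1 := by simp
      rw [hIic, htotal, sub_zero, Phi_neg, zero_pow two_ne_zero, zero_div, Real.exp_zero,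
        one_mul] at hadd
      linarith
    · refine min_eq_right (Real.one_le_exp ?_)
      exact (not_le.mp fun h => not_lt.mpr ((hiff x).mp h) hx).le

lemma sqrt_mul_exp {P : ℝ} (hP : 0 < P) (x : ℝ) :
    √(P * Real.exp x) = √P * Real.exp (x / 2) := by
  rw [Real.sqrt_mul hP.le, ← Real.exp_half]

lemma F_mul_exp {P : ℝ} (hP : 0 < P) (x : ℝ) :
    F P (P * Real.exp x) = √P * (Real.exp (x / 2) - min (Real.exp x) 1) := by
  obtain ⟨q, hq, rfl⟩ : ∃ q, 0 < q ∧ P = q ^ 2 :=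
    ⟨√P, Real.sqrt_pos.mpr hP, (Real.sq_sqrt hP.le).symm⟩
  have he : Real.exp x = Real.exp (x / 2) ^ 2 := by rw [← Real.exp_nat_mul]; ring_nf
  have hpos := Real.exp_pos (x / 2)
  rw [F, sqrt_mul_exp hP, Real.sqrt_sq hq.le, he]
  generalize Real.exp (x / 2) = u at hpos
  rcases le_total u 1 with hu | hu
  · have h1 : 1 / q ≤ 1 / (q * u) := one_div_le_one_div_of_le (by positivity) (by nlinarith)
    rw [max_eq_left (by linarith), max_eq_right (by nlinarith), min_eq_left (by nlinarith)]
    field_simp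
    ring
  · have h1 : 1 / (q * u) ≤ 1 / q := one_div_le_one_div_of_le hq (by nlinarith)
    rw [max_eq_right (by linarith), max_eq_left (by nlinarith), min_eq_right (by nlinarith)]
    ring

/-- The undiscounted one-step expectation for a lognormal price with log-drift `m` and
log-volatility `s`. -/
lemma integral_sqrt_add_F {Ω : Type*} [MeasurableSpace Ω] {μ : Measure Ω}
    {Z : Ω → ℝ} (hZ : Measure.map Z μ = gaussianReal 0 1) (m γ : ℝ) {s P : ℝ}
    (hs : 0 < s) (hP : 0 < P) :
    ∫ ω, (2 * √(P * Real.exp (m + s * Z ω)) + γ * F P (P * Real.exp (m + s * Z ω))) ∂μ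
      = √P * ((2 + γ) * Real.exp (m / 2 + s ^ 2 / 8)
        - γ * (Real.exp (m + s ^ 2 / 2) * (1 - Phi (m / s + s)) + Phi (m / s))) := by
  have hZm : AEMeasurable Z μ := aemeasurable_of_map_neZero (by rw [hZ]; infer_instance)
  have hsplit (z : ℝ) : 2 * √(P * Real.exp (m + s * z)) + γ * F P (P * Real.exp (m + s * z))
      = √P * ((2 + γ) * Real.exp (m / 2 + s / 2 * z) - γ * min (Real.exp (m + s * z)) 1) := by
    rw [sqrt_mul_exp hP, F_mul_exp hP, show m / 2 + s / 2 * z = (m + s * z) / 2 by ring]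
    ring
  simp_rw [hsplit]
  rw [← integral_map (f := fun z => √P * ((2 + γ) * Real.exp (m / 2 + s / 2 * z)
    - γ * min (Real.exp (m + s * z)) 1)) hZm
    (Continuous.aestronglyMeasurable (by fun_prop)), hZ, integral_const_mul,
    integral_sub ((integrable_exp_add_mul_gaussianReal _ _).const_mul _)
      ((integrable_min_exp_gaussianReal _ _).const_mul _),
    integral_const_mul, integral_const_mul, integral_min_exp_gaussianReal m hs]
  simp_rw [Real.exp_add (m / 2)]
  rw [integral_const_mul, integral_exp_mul_gaussianReal]
  ring_nf

theorem stmt7 {Ω : Type*} [MeasurableSpace Ω] (μ : Measure Ω) [IsProbabilityMeasure μ]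
    (Z : Ω → ℝ) (hZ : Measure.map Z μ = gaussianReal 0 1)
    (r σ Δt γ : ℝ) (hr : 0 ≤ r) (hσ : 0 < σ) (hΔt : 0 < Δt) (hγpos : 0 < γ)
    (hγ : γ < gammaStar r σ Δt) :
    ∀ P : ℝ, 0 < P →
      (Real.exp (-(r*Δt)) *
          ∫ ω, (2 * Real.sqrt (P * Real.exp ((r - σ^2/2)*Δt + σ * Real.sqrt Δt * Z ω))
              + γ * F P (P * Real.exp ((r - σ^2/2)*Δt + σ * Real.sqrt Δt * Z ω))) ∂μ)
        = 2 * Real.sqrt P * (Real.exp (-(r + σ^2/4)*Δt/2)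
            + (1 - Real.exp (-(r + σ^2/4)*Δt/2)) * γ / gammaStar r σ Δt) ∧
      (Real.exp (-(r*Δt)) *
          ∫ ω, (2 * Real.sqrt (P * Real.exp ((r - σ^2/2)*Δt + σ * Real.sqrt Δt * Z ω))
              + γ * F P (P * Real.exp ((r - σ^2/2)*Δt + σ * Real.sqrt Δt * Z ω))) ∂μ)
        < 2 * Real.sqrt P ∧
      2 * Real.sqrt P
        = max (2 * Real.sqrt P)
            (Real.exp (-(r*Δt)) *
              ∫ ω, (2 * Real.sqrt (P * Real.exp ((r - σ^2/2)*Δt + σ * Real.sqrt Δt * Z ω))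
                  + γ * F P (P * Real.exp ((r - σ^2/2)*Δt + σ * Real.sqrt Δt * Z ω))) ∂μ) := by
  intro P hP
  have hsΔ : 0 < √Δt := Real.sqrt_pos.mpr hΔt
  have hsq : √Δt ^ 2 = Δt := Real.sq_sqrt hΔt.le
  have hγs : 0 < gammaStar r σ Δt := hγpos.trans hγ
  have hA : Real.exp (-(r + σ^2/4)*Δt/2) < 1 := by
    rw [Real.exp_lt_one_iff]
    have : 0 < (r + σ^2/4) * Δt := by positivity
    linarith
  have hd₂ : (r - σ^2/2) * Δt / (σ * √Δt) = (r - σ^2/2) * √Δt / σ := by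
    field_simp
    rw [hsq]
  have hd₁ : (r - σ^2/2) * √Δt / σ + σ * √Δt = (r + σ^2/2) * √Δt / σ := by
    field_simp
    ring
  have hvalue : Real.exp (-(r*Δt)) *
      ∫ ω, (2 * √(P * Real.exp ((r - σ^2/2)*Δt + σ * √Δt * Z ω))
        + γ * F P (P * Real.exp ((r - σ^2/2)*Δt + σ * √Δt * Z ω))) ∂μ
      = 2 * √P * (Real.exp (-(r + σ^2/4)*Δt/2)
        + (1 - Real.exp (-(r + σ^2/4)*Δt/2)) * γ / gammaStar r σ Δt) := by
    have hsqrt : Real.exp (-(r + σ^2/4)*Δt/2) = Real.exp (-(r*Δt))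
        * Real.exp ((r - σ^2/2) * Δt / 2 + (σ * √Δt) ^ 2 / 8) := by
      rw [← Real.exp_add, mul_pow, hsq]
      ring_nf
    have hone : Real.exp (-(r*Δt))
        * Real.exp ((r - σ^2/2) * Δt + (σ * √Δt) ^ 2 / 2) = 1 := by
      rw [← Real.exp_add, mul_pow, hsq, Real.exp_eq_one_iff]
      ring
    have hfee : 2 * ((1 - Real.exp (-(r + σ^2/4)*Δt/2)) / gammaStar r σ Δt)
        = Phi ((r + σ^2/2) * √Δt / σ) - Real.exp (-(r*Δt)) * Phi ((r - σ^2/2) * √Δt / σ)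
          - (1 - Real.exp (-(r + σ^2/4)*Δt/2)) := by
      have h1A := (sub_pos.mpr hA).ne'
      rw [gammaStar, div_eq_mul_inv, mul_inv, inv_inv]
      generalize Real.exp (-(r + σ^2/4)*Δt/2) = A at h1A ⊢
      generalize Phi ((r + σ^2/2) * √Δt / σ) = p
      generalize Phi ((r - σ^2/2) * √Δt / σ) = q
      field_simp
      ring
    rw [integral_sqrt_add_F hZ _ γ (mul_pos hσ hsΔ) hP, hd₂, hd₁]
    linear_combination (-(2 + γ) * √P) * hsqrt
      - γ * √P * (1 - Phi ((r + σ^2/2) * √Δt / σ)) * hone - γ * √P * hfee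
  have hlt : 2 * √P * (Real.exp (-(r + σ^2/4)*Δt/2)
      + (1 - Real.exp (-(r + σ^2/4)*Δt/2)) * γ / gammaStar r σ Δt) < 2 * √P := by
    have hratio : γ / gammaStar r σ Δt < 1 := (div_lt_one hγs).mpr hγ
    have hPpos : 0 < 2 * √P := by positivity
    refine mul_lt_of_lt_one_right hPpos ?_
    rw [mul_div_assoc (1 - _)]
    nlinarith [mul_lt_mul_of_pos_left hratio (sub_pos.mpr hA)]
  rw [hvalue]
  exact ⟨rfl, hlt, (max_eq_left hlt.le).symm⟩
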